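/- arXiv:0910.2311 — 2 statements merged into one kernel-verified Lean document; each statement's English description precedes it below -/
import Mathlib

section
/- Let ψ: ℝ^m → ℝ be smooth and ℤ^m-periodic. For j, l ∈ {0,1,...,k-1}^m with j ≠ l, the L² inner product ∫_{[0,1]^m×[0,1]^m} θ_l(z) conj(θ_j(z)) e^{-2kπy² - 4kπψ(y)} det(I + Hess ψ(y)) dx dy equals zero, where z = x + iy. That is, the theta functions of level k are pairwise orthogonal with respect to this inner product. -/
open scoped Real BigOperators
open MeasureTheory

/-- The level-`k` theta function. -/
noncomputable def theta {m : ℕ} (k : ℕ) (j : Fin m → ℤ) (z : Fin m → ℂ) : ℂ :=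
  ∑' n : Fin m → ℤ, Complex.exp
    (-(π : ℂ) * (∑ α, (((j α + (k : ℤ) * n α : ℤ) : ℂ)) ^ 2) / (k : ℂ)
      + 2 * (π : ℂ) * Complex.I * ∑ α, ((j α + (k : ℤ) * n α : ℤ) : ℂ) * z α)

/-- The Hessian matrix of a function on `ℝ^m`. -/
noncomputable def hess {m : ℕ} (f : (Fin m → ℝ) → ℝ) (y : Fin m → ℝ) :
    Matrix (Fin m) (Fin m) ℝ :=
  Matrix.of fun a b =>
    fderiv ℝ (fun v => fderiv ℝ f v (Pi.single b 1)) y (Pi.single a 1)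

lemma theta_shift_aux {m : ℕ} (k : ℕ) (hk : 0 < k) (l : Fin m → ℤ) (z : Fin m → ℂ)
    (w : Fin m → ℤ) :
    theta k l (fun α => z α + (w α : ℂ) / (k : ℂ)) =
      Complex.exp (2 * (π : ℂ) * Complex.I * ((∑ α, (l α : ℂ) * w α) / k)) * theta k l z := by
  have hk' : (k : ℂ) ≠ 0 := by exact_mod_cast hk.ne'
  unfold theta
  rw [← tsum_mul_left]
  congr 1
  ext n
  rw [← Complex.exp_add, Complex.exp_eq_exp_iff_exists_int]
  refine ⟨∑ α, n α * w α, ?_⟩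
  have h1 : ∑ α, ((l α + (k : ℤ) * n α : ℤ) : ℂ) * (z α + (w α : ℂ) / (k : ℂ)) =
      ∑ α, ((l α + (k : ℤ) * n α : ℤ) : ℂ) * z α + (∑ α, (l α : ℂ) * w α) / k
        + ∑ α, (n α : ℂ) * w α := by
    rw [Finset.sum_div, ← Finset.sum_add_distrib, ← Finset.sum_add_distrib]
    refine Finset.sum_congr rfl fun α _ => ?_
    push_cast
    field_simp
    ring
  rw [h1]
  push_cast
  ring

open scoped Pointwise in
/-- A function on `ℝ^m` that is `ℤ^m`-periodic and gets multiplied by `c ≠ 1` under a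
translation has zero integral over the unit cube. -/
lemma cube_integral_zero_aux {m : ℕ} (F : (Fin m → ℝ) → ℂ) (v : Fin m → ℝ) (c : ℂ) (hc : c ≠ 1)
    (hF : ∀ (x : Fin m → ℝ) (n : Fin m → ℤ), F ((fun α => (n α : ℝ)) + x) = F x)
    (hv : ∀ x, F (v + x) = c * F x) :
    ∫ x in Set.pi Set.univ fun _ : Fin m => Set.Icc (0:ℝ) 1, F x = 0 := by
  have hae : (Set.pi Set.univ fun _ : Fin m => Set.Ico (0:ℝ) 1) =ᵐ[volume]
      (Set.pi Set.univ fun _ : Fin m => Set.Icc (0:ℝ) 1) := by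
    rw [Set.pi_univ_Icc]
    exact Measure.univ_pi_Ico_ae_eq_Icc
  rw [← setIntegral_congr_set hae]
  set b := Pi.basisFun ℝ (Fin m)
  have hD := ZSpan.isAddFundamentalDomain b (volume : Measure (Fin m → ℝ))
  have hD' := hD.vadd_of_comm v
  have hinv : ∀ (g : Submodule.span ℤ (Set.range b)) (x : Fin m → ℝ), F (g +ᵥ x) = F x := by
    intro g x
    have hg := (b.mem_span_iff_repr_mem ℤ (g : Fin m → ℝ)).1 g.2
    choose n hn using hg
    have : (g : Fin m → ℝ) = fun α => (n α : ℝ) := by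
      ext α
      have := hn α
      simpa [b] using this.symm
    have h2 : g +ᵥ x = (g : Fin m → ℝ) + x := rfl
    rw [h2, this, hF]
  haveI : VAddInvariantMeasure (Submodule.span ℤ (Set.range b)) (Fin m → ℝ) volume :=
    inferInstanceAs (VAddInvariantMeasure (Submodule.span ℤ (Set.range b)).toAddSubgroup
      (Fin m → ℝ) volume)
  have key := hD'.setIntegral_eq hD hinv
  have himg : ∫ x in v +ᵥ ZSpan.fundamentalDomain b, F x
      = ∫ x in ZSpan.fundamentalDomain b, F (v + x) :=
    (measurePreserving_add_left volume v).setIntegral_image_emb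
      (measurableEmbedding_addLeft v) F _
  rw [himg] at key
  simp only [hv] at key
  rw [integral_const_mul] at key
  rw [ZSpan.fundamentalDomain_pi_basisFun] at key
  by_contra hne
  exact hc (mul_right_cancel₀ hne (by rw [key, one_mul]))

/-- Orthogonality of the theta functions of level `k` with respect to the inner
product induced by the hermitian metric `e^{-2πy²-4πψ(y)}`. -/
theorem theta_orthogonal {m : ℕ} (k : ℕ) (hk : 0 < k)
    (ψ : (Fin m → ℝ) → ℝ) (hψ : ContDiff ℝ (⊤ : ℕ∞) ψ)
    (hper : ∀ (y : Fin m → ℝ) (n : Fin m → ℤ), ψ (y + fun α => (n α : ℝ)) = ψ y)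
    (j l : Fin m → ℤ)
    (hj : ∀ α, 0 ≤ j α ∧ j α < k) (hl : ∀ α, 0 ≤ l α ∧ l α < k)
    (hne : j ≠ l) :
    (∫ x in Set.pi Set.univ fun _ : Fin m => Set.Icc (0:ℝ) 1,
      ∫ y in Set.pi Set.univ fun _ : Fin m => Set.Icc (0:ℝ) 1,
        theta k l (fun α => (x α : ℂ) + Complex.I * (y α : ℂ))
          * (starRingEnd ℂ) (theta k j (fun α => (x α : ℂ) + Complex.I * (y α : ℂ)))
          * Real.exp (-2 * k * π * (∑ α, (y α) ^ 2) - 4 * k * π * ψ y)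
          * ((1 + hess ψ y).det : ℝ)) = 0 := by
  set F : (Fin m → ℝ) → ℂ := fun x => ∫ y in Set.pi Set.univ fun _ : Fin m => Set.Icc (0:ℝ) 1,
        theta k l (fun α => (x α : ℂ) + Complex.I * (y α : ℂ))
          * (starRingEnd ℂ) (theta k j (fun α => (x α : ℂ) + Complex.I * (y α : ℂ)))
          * Real.exp (-2 * k * π * (∑ α, (y α) ^ 2) - 4 * k * π * ψ y)
          * ((1 + hess ψ y).det : ℝ) with hFdef
  have hk' : (k : ℂ) ≠ 0 := by exact_mod_cast hk.ne'
  have hshift : ∀ (w : Fin m → ℤ) (x : Fin m → ℝ),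
      F ((fun α => (w α : ℝ) / k) + x) =
        Complex.exp (2 * (π : ℂ) * Complex.I * ((∑ α, ((l α - j α : ℤ) : ℂ) * w α) / k)) * F x := by
    intro w x
    simp only [hFdef]
    rw [← integral_const_mul]
    congr 1
    ext y
    have hz : (fun α => ((((fun α => (w α : ℝ) / k) + x : Fin m → ℝ) α : ℝ) : ℂ)
        + Complex.I * (y α : ℂ)) =
        fun α => ((x α : ℂ) + Complex.I * (y α : ℂ)) + (w α : ℂ) / (k : ℂ) := by
      ext α
      simp only [Pi.add_apply]
      push_cast
      ring
    have he : Complex.exp (2 * (π : ℂ) * Complex.I *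
          ((∑ α, ((l α - j α : ℤ) : ℂ) * w α) / k)) =
        Complex.exp (2 * (π : ℂ) * Complex.I * ((∑ α, (l α : ℂ) * w α) / k)) *
        (starRingEnd ℂ)
          (Complex.exp (2 * (π : ℂ) * Complex.I * ((∑ α, (j α : ℂ) * w α) / k))) := by
      rw [← Complex.exp_conj, ← Complex.exp_add]
      congr 1
      simp only [map_mul, map_div₀, map_sum, Complex.conj_I, Complex.conj_ofReal, map_natCast,
        map_intCast, map_ofNat]
      push_cast
      simp only [sub_mul, Finset.sum_sub_distrib]
      ring
    rw [hz, theta_shift_aux k hk l (fun α => (x α : ℂ) + Complex.I * (y α : ℂ)),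
      theta_shift_aux k hk j (fun α => (x α : ℂ) + Complex.I * (y α : ℂ)), he, map_mul]
    ring
  obtain ⟨a, ha⟩ := Function.ne_iff.1 hne
  refine cube_integral_zero_aux F (fun α => ((Pi.single a 1 : Fin m → ℤ) α : ℝ) / k) _ ?_ ?_
    (hshift (Pi.single a 1))
  · rw [Ne, Complex.exp_eq_one_iff]
    rintro ⟨n, hn⟩
    have hs : ∑ α, ((l α - j α : ℤ) : ℂ) * ((Pi.single a 1 : Fin m → ℤ) α : ℂ)
        = ((l a - j a : ℤ) : ℂ) := by
      rw [Finset.sum_eq_single a]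
      · simp
      · intro β _ hβ
        simp [hβ]
      · simp
    rw [hs, mul_comm (n : ℂ)] at hn
    have hn2 := mul_left_cancel₀ Complex.two_pi_I_ne_zero hn
    rw [div_eq_iff hk'] at hn2
    have hn3 : l a - j a = n * k := by exact_mod_cast hn2
    have h1 := hj a
    have h2 := hl a
    have : n = 0 := by
      have hk0 : (0 : ℤ) < k := by exact_mod_cast hk
      have hlt : n < 1 := by nlinarith
      have hgt : -1 < n := by nlinarith
      omega
    rw [this] at hn3
    apply ha
    linarith
  · intro x n
    have := hshift (fun α => (k : ℤ) * n α) x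
    have hv : (fun α => (((k : ℤ) * n α : ℤ) : ℝ) / k) = fun α => (n α : ℝ) := by
      ext α
      have : (k : ℝ) ≠ 0 := by exact_mod_cast hk.ne'
      push_cast
      field_simp
    rw [hv] at this
    rw [this]
    convert one_mul _
    rw [Complex.exp_eq_one_iff]
    refine ⟨∑ α, (l α - j α) * n α, ?_⟩
    have : (∑ α, ((l α - j α : ℤ) : ℂ) * (((k : ℤ) * n α : ℤ) : ℂ)) / k =
        ((∑ α, (l α - j α) * n α : ℤ) : ℂ) := by
      rw [div_eq_iff hk']
      push_cast
      rw [Finset.sum_mul]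
      exact Finset.sum_congr rfl fun α _ => by ring
    rw [this]
    ring
end

section
/- Let ψ: ℝ^m → ℝ be smooth and ℤ^m-periodic. Then for j ∈ {0,...,k-1}^m, the squared norm ‖θ_j‖² := (4π)^m ∫_{[0,1]^m×[0,1]^m} |θ_j(z)|² e^{-2kπy² - 4kπψ(y)} det(I + Hess ψ(y)) dx dy equals (4π)^m ∫_{ℝ^m} e^{-2kπ(y + j/k)²} e^{-4kπψ(y)} det(I + Hess ψ(y)) dy. -/
open scoped Real BigOperators
open MeasureTheory

noncomputable def thAmp {m : ℕ} (k : ℕ) (j n : Fin m → ℤ) (y : Fin m → ℝ) : ℝ :=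
  Real.exp (-(k * π) * ∑ α, (y α + (j α : ℝ) / k + n α) ^ 2)

noncomputable def thPhase {m : ℕ} (k : ℕ) (j n : Fin m → ℤ) (x : Fin m → ℝ) : ℂ :=
  Complex.exp (((2 * π * ∑ α, ((j α + (k : ℤ) * n α : ℤ) : ℝ) * x α : ℝ) : ℂ) * Complex.I)

noncomputable def thBound {m : ℕ} (k : ℕ) (n : Fin m → ℤ) : ℝ :=
  ∏ α, Real.exp (-π * (k * (n α : ℝ) ^ 2 - 2 * (2 * k) * |(n α : ℝ)|))

abbrev cube (m : ℕ) : Set (Fin m → ℝ) := Set.pi Set.univ fun _ : Fin m => Set.Icc (0:ℝ) 1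

lemma summable_fin_prod (b : ℤ → ℝ) (hb : Summable b) (h0 : ∀ n, 0 ≤ b n) (m : ℕ) :
    Summable fun n : Fin m → ℤ => ∏ α, b (n α) := by
  induction m with
  | zero => exact Summable.of_finite
  | succ m ih =>
    rw [← (Fin.consEquiv (fun _ : Fin (m+1) => ℤ)).summable_iff]
    have := Summable.mul_of_nonneg hb ih h0 (fun n => Finset.prod_nonneg fun i _ => h0 _)
    refine this.congr fun p => ?_
    simp [Fin.consEquiv, Fin.prod_univ_succ]

lemma thBound_summable {m : ℕ} (k : ℕ) (hk : 0 < k) :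
    Summable (fun n : Fin m → ℤ => thBound k n) := by
  refine summable_fin_prod
    (fun n : ℤ => Real.exp (-π * (k * (n : ℝ) ^ 2 - 2 * (2 * k) * |(n : ℝ)|))) ?_ ?_ m
  · have := summable_pow_mul_jacobiTheta₂_term_bound (2 * k : ℝ) (T := k) (by positivity) 0
    simpa using this
  · intro n; positivity

lemma thAmp_pos {m : ℕ} (k : ℕ) (j n : Fin m → ℤ) (y : Fin m → ℝ) : 0 < thAmp k j n y :=
  Real.exp_pos _

lemma thAmp_le {m : ℕ} (k : ℕ) (hk : 0 < k) (j : Fin m → ℤ) (hj : ∀ α, 0 ≤ j α ∧ j α < k)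
    (n : Fin m → ℤ) (y : Fin m → ℝ) (hy : y ∈ cube m) : thAmp k j n y ≤ thBound k n := by
  unfold thAmp thBound
  rw [Finset.mul_sum, Real.exp_sum]
  refine Finset.prod_le_prod (fun _ _ => (Real.exp_pos _).le) fun α _ => ?_
  apply Real.exp_le_exp.2
  have hk' : (0:ℝ) < k := by exact_mod_cast hk
  have h1 := hy α (Set.mem_univ _)
  have h2 : 0 ≤ (j α : ℝ) / k := div_nonneg (by exact_mod_cast (hj α).1) hk'.le
  have h3 : (j α : ℝ) / k ≤ 1 := by
    rw [div_le_one hk']; exact_mod_cast (hj α).2.le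
  set c := y α + (j α : ℝ) / k
  have hc0 : 0 ≤ c := add_nonneg h1.1 h2
  have hc2 : c ≤ 2 := by have := h1.2; simp only [c]; linarith
  have h4 : -(2 * 2 * |(n α : ℝ)|) ≤ 2 * c * n α := by
    have := neg_abs_le (n α : ℝ)
    nlinarith [abs_nonneg (n α : ℝ)]
  have h5 : (n α : ℝ) ^ 2 - 2 * 2 * |(n α : ℝ)| ≤ (c + n α) ^ 2 := by nlinarith [sq_nonneg c]
  have h6 := mul_le_mul_of_nonneg_left h5 (by positivity : (0:ℝ) ≤ k * π)
  linarith

lemma thAmp_summable {m : ℕ} (k : ℕ) (hk : 0 < k) (j : Fin m → ℤ)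
    (hj : ∀ α, 0 ≤ j α ∧ j α < k) (y : Fin m → ℝ) (hy : y ∈ cube m) :
    Summable (fun n => thAmp k j n y) :=
  (thBound_summable k hk).of_nonneg_of_le (fun n => (thAmp_pos k j n y).le)
    (fun n => thAmp_le k hk j hj n y hy)

lemma norm_thPhase {m : ℕ} (k : ℕ) (j n : Fin m → ℤ) (x : Fin m → ℝ) :
    ‖thPhase k j n x‖ = 1 := Complex.norm_exp_ofReal_mul_I _

lemma continuous_thAmp {m : ℕ} (k : ℕ) (j n : Fin m → ℤ) : Continuous (thAmp k j n) := by
  unfold thAmp; fun_prop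

lemma continuous_thPhase {m : ℕ} (k : ℕ) (j n : Fin m → ℤ) : Continuous (thPhase k j n) := by
  unfold thPhase; fun_prop

lemma theta_term {m : ℕ} (k : ℕ) (hk : 0 < k) (j : Fin m → ℤ) (x y : Fin m → ℝ)
    (n : Fin m → ℤ) :
    Complex.exp
    (-(π : ℂ) * (∑ α, (((j α + (k : ℤ) * n α : ℤ) : ℂ)) ^ 2) / (k : ℂ)
      + 2 * (π : ℂ) * Complex.I * ∑ α, ((j α + (k : ℤ) * n α : ℤ) : ℂ) *
        ((x α : ℂ) + Complex.I * (y α : ℂ))) =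
    (Real.exp (k * π * ∑ α, (y α) ^ 2) : ℂ) * ((thAmp k j n y : ℂ) * thPhase k j n x) := by
  have hk' : (k : ℂ) ≠ 0 := by exact_mod_cast hk.ne'
  unfold thAmp thPhase
  push_cast
  rw [← Complex.exp_add, ← Complex.exp_add]
  congr 1
  simp only [Finset.mul_sum, Finset.sum_mul, Finset.sum_div, ← Finset.sum_add_distrib]
  refine Finset.sum_congr rfl fun α _ => ?_
  field_simp
  ring_nf
  simp only [Complex.I_sq]
  ring

lemma norm_theta_sq {m : ℕ} (k : ℕ) (hk : 0 < k) (j : Fin m → ℤ) (x y : Fin m → ℝ) :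
    ‖theta k j (fun α => (x α : ℂ) + Complex.I * (y α : ℂ))‖ ^ 2
      * Real.exp (-2 * k * π * (∑ α, (y α) ^ 2)) =
    ‖∑' n, (thAmp k j n y : ℂ) * thPhase k j n x‖ ^ 2 := by
  unfold theta
  simp_rw [theta_term k hk j x y]
  rw [tsum_mul_left, norm_mul, mul_pow, Complex.norm_real, Real.norm_eq_abs, Real.abs_exp,
    ← Real.exp_nat_mul, mul_right_comm, ← Real.exp_add]
  rw [show ((2:ℕ):ℝ) * (k * π * ∑ α, y α ^ 2) + -2 * k * π * ∑ α, y α ^ 2 = 0 by push_cast; ring]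
  simp

lemma phase_mul_conj {m : ℕ} (k : ℕ) (j n p : Fin m → ℤ) (x : Fin m → ℝ) :
    thPhase k j n x * (starRingEnd ℂ) (thPhase k j p x) =
      ∏ α, Complex.exp ((2 * π * Complex.I * ((k * (n α - p α) : ℤ) : ℂ)) * x α) := by
  unfold thPhase
  rw [← Complex.exp_conj, ← Complex.exp_add, ← Complex.exp_sum]
  congr 1
  simp only [map_mul, Complex.conj_ofReal, Complex.conj_I]
  push_cast
  simp only [Finset.mul_sum, Finset.sum_mul, ← Finset.sum_neg_distrib, mul_neg,
    ← Finset.sum_add_distrib]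
  refine Finset.sum_congr rfl fun α _ => ?_
  ring

lemma integral_exp_one (N : ℤ) :
    ∫ t in Set.Icc (0:ℝ) 1, Complex.exp ((2 * π * Complex.I * (N : ℂ)) * t) =
      if N = 0 then 1 else 0 := by
  rw [integral_Icc_eq_integral_Ioc, ← intervalIntegral.integral_of_le zero_le_one]
  split_ifs with h
  · simp [h]
  · rw [integral_exp_mul_complex]
    · have : Complex.exp (2 * π * Complex.I * (N : ℂ)) = 1 := by
        rw [mul_comm]; exact Complex.exp_int_mul_two_pi_mul_I N
      simp [this]
    · simp [h, Real.pi_ne_zero]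

lemma integral_phase {m : ℕ} (k : ℕ) (hk : 0 < k) (j n p : Fin m → ℤ) :
    ∫ x in cube m, thPhase k j n x * (starRingEnd ℂ) (thPhase k j p x) =
      if n = p then 1 else 0 := by
  simp_rw [phase_mul_conj]
  rw [volume_pi, Measure.restrict_pi_pi, integral_fintype_prod_eq_prod
    (f := fun α (t : ℝ) => Complex.exp ((2 * π * Complex.I * ((k * (n α - p α) : ℤ) : ℂ)) * t))]
  simp_rw [integral_exp_one]
  split_ifs with h
  · subst h; simp
  · obtain ⟨α, hα⟩ := Function.ne_iff.1 h
    refine Finset.prod_eq_zero (Finset.mem_univ α) ?_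
    rw [if_neg]
    simp [hk.ne', sub_eq_zero, hα]

lemma isCompact_cube (m : ℕ) : IsCompact (cube m) := isCompact_univ_pi fun _ => isCompact_Icc

lemma parseval {m : ℕ} (k : ℕ) (hk : 0 < k) (j : Fin m → ℤ) (a : (Fin m → ℤ) → ℝ)
    (ha0 : ∀ n, 0 ≤ a n) (ha : Summable a) :
    ∫ x in cube m, ‖∑' n, (a n : ℂ) * thPhase k j n x‖ ^ 2 = ∑' n, a n ^ 2 := by
  have hn : ∀ x, Summable fun n => ‖(a n : ℂ) * thPhase k j n x‖ := by
    intro x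
    simpa [norm_thPhase, abs_of_nonneg (ha0 _)] using ha
  let F : (Fin m → ℤ) × (Fin m → ℤ) → (Fin m → ℝ) → ℂ := fun q x =>
    ((a q.1 : ℂ) * thPhase k j q.1 x) * (starRingEnd ℂ) ((a q.2 : ℂ) * thPhase k j q.2 x)
  have hF : ∀ x, (((‖∑' n, (a n : ℂ) * thPhase k j n x‖ ^ 2 : ℝ)) : ℂ) = ∑' q, F q x := by
    intro x
    rw [Complex.ofReal_pow, ← Complex.mul_conj', Complex.conj_tsum]
    exact tsum_mul_tsum_of_summable_norm (hn x) (by simpa using hn x)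
  have hFn : ∀ q x, ‖F q x‖ = a q.1 * a q.2 := by
    intro q x
    simp [F, norm_thPhase, abs_of_nonneg (ha0 _)]
  have hFc : ∀ q, Continuous (F q) := by
    intro q
    have := continuous_thPhase k j q.1
    have := continuous_thPhase k j q.2
    simp only [F]
    fun_prop
  have hs := hasSum_integral_of_summable_integral_norm (μ := volume.restrict (cube m)) (F := F)
    (fun q => ((hFc q).continuousOn.integrableOn_compact (isCompact_cube m))) (by
      simp_rw [hFn]
      simp only [integral_const, smul_eq_mul]
      exact (Summable.mul_of_nonneg ha ha ha0 ha0).mul_left _)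
  have hI : ∀ q, ∫ x in cube m, F q x = if q.1 = q.2 then ((a q.1 ^ 2 : ℝ) : ℂ) else 0 := by
    intro q
    have : ∀ x, F q x = ((a q.1 : ℂ) * a q.2) *
        (thPhase k j q.1 x * (starRingEnd ℂ) (thPhase k j q.2 x)) := by
      intro x; simp only [F, map_mul, Complex.conj_ofReal]; ring
    simp_rw [this]
    rw [integral_const_mul, integral_phase k hk]
    split_ifs with h
    · rw [h]; push_cast; ring
    · simp
  simp_rw [hI, ← hF] at hs
  have hd : Function.Injective (fun n : Fin m → ℤ => (n, n)) := fun a b h => (Prod.ext_iff.1 h).1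
  rw [← hd.hasSum_iff] at hs
  · simp only [Function.comp_def, if_true] at hs
    rw [integral_complex_ofReal, Complex.hasSum_ofReal] at hs
    exact hs.tsum_eq.symm
  · rintro ⟨n, p⟩ h
    rw [if_neg]
    intro (hnp : n = p)
    exact h ⟨n, by rw [hnp]⟩

lemma thAmp_shift {m : ℕ} (k : ℕ) (j n : Fin m → ℤ) (y : Fin m → ℝ) :
    thAmp k j 0 (y + fun α => (n α : ℝ)) = thAmp k j n y := by
  unfold thAmp
  congr 2
  refine Finset.sum_congr rfl fun α _ => ?_
  simp only [Pi.add_apply, Pi.zero_apply, Int.cast_zero]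
  ring

lemma thAmp_sq_integrable {m : ℕ} (k : ℕ) (hk : 0 < k) (j : Fin m → ℤ) :
    Integrable (fun y => thAmp k j 0 y ^ 2) := by
  have hk' : (0:ℝ) < k := by exact_mod_cast hk
  have h1 : ∀ α, Integrable (fun t : ℝ => Real.exp (-(2 * k * π) * (t + (j α : ℝ) / k) ^ 2)) :=
    fun α => (integrable_exp_neg_mul_sq (b := 2 * k * π) (by positivity)).comp_add_right _
  have := Integrable.fintype_prod (μ := fun _ : Fin m => (volume : Measure ℝ)) h1
  rw [← volume_pi] at this
  refine this.congr (Filter.Eventually.of_forall fun y => ?_)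
  simp only [thAmp]
  rw [← Real.exp_sum, ← Real.exp_nat_mul]
  congr 1
  simp only [Finset.mul_sum]
  refine Finset.sum_congr rfl fun α _ => ?_
  simp
  ring

lemma periodic_bounded {m : ℕ} (W : (Fin m → ℝ) → ℝ) (hW : Continuous W)
    (hper : ∀ (y : Fin m → ℝ) (n : Fin m → ℤ), W (y + fun α => (n α : ℝ)) = W y) :
    ∃ C, ∀ y, ‖W y‖ ≤ C := by
  obtain ⟨C, hC⟩ := (isCompact_cube m).exists_bound_of_continuousOn hW.continuousOn
  refine ⟨C, fun y => ?_⟩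
  have h : y = (fun α => Int.fract (y α)) + fun α => ((⌊y α⌋ : ℤ) : ℝ) := by
    ext α; simp
  rw [h, hper _ (fun α => ⌊y α⌋)]
  exact hC _ fun α _ => ⟨Int.fract_nonneg _, (Int.fract_lt_one _).le⟩

lemma unfold_integral {m : ℕ} (k : ℕ) (hk : 0 < k) (j : Fin m → ℤ)
    (hj : ∀ α, 0 ≤ j α ∧ j α < k) (W : (Fin m → ℝ) → ℝ) (hW : Continuous W)
    (hper : ∀ (y : Fin m → ℝ) (n : Fin m → ℤ), W (y + fun α => (n α : ℝ)) = W y) :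
    ∫ y in cube m, (∑' n, thAmp k j n y ^ 2) * W y = ∫ y, thAmp k j 0 y ^ 2 * W y := by
  obtain ⟨C, hC⟩ := periodic_bounded W hW hper
  have hint : Integrable (fun y => thAmp k j 0 y ^ 2 * W y) :=
    (thAmp_sq_integrable k hk j).mul_bdd (c := C) hW.aestronglyMeasurable
      (Filter.Eventually.of_forall hC)
  let s : (Fin m → ℤ) → Set (Fin m → ℝ) := fun n => {y | (fun α => ⌊y α⌋) = n}
  have hsm : ∀ n, MeasurableSet (s n) := by
    intro n
    have : Measurable (fun y : Fin m → ℝ => (fun α => ⌊y α⌋ : Fin m → ℤ)) :=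
      measurable_pi_lambda _ fun α => Int.measurable_floor.comp (measurable_pi_apply α)
    exact this (measurableSet_singleton n)
  have hsd : Pairwise (Function.onFun Disjoint s) := by
    intro n p hnp
    refine Set.disjoint_left.2 fun y (h1 : _ = n) (h2 : _ = p) => hnp (h1.symm.trans h2)
  have hsu : ⋃ n, s n = Set.univ := by
    ext y; simp [s]
  have hU := hasSum_integral_iUnion (μ := volume) hsm hsd hint.integrableOn
  rw [hsu, setIntegral_univ] at hU
  have hs0 : s 0 =ᵐ[volume] cube m := by
    have h1 : s 0 = Set.pi Set.univ fun _ : Fin m => Set.Ico (0:ℝ) 1 := by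
      ext y
      simp only [s, Set.mem_ofPred_eq, funext_iff, Set.mem_pi, Set.mem_univ, true_imp_iff,
        Pi.zero_apply, Int.floor_eq_zero_iff]
    rw [h1, volume_pi]
    exact Measure.pi_Ico_ae_eq_pi_Icc
  have hpiece : ∀ n, ∫ y in s n, thAmp k j 0 y ^ 2 * W y =
      ∫ y in cube m, thAmp k j n y ^ 2 * W y := by
    intro n
    have hmp := measurePreserving_add_right (volume : Measure (Fin m → ℝ)) (fun α => (n α : ℝ))
    have := hmp.setIntegral_preimage_emb (measurableEmbedding_addRight _)
      (fun y => thAmp k j 0 y ^ 2 * W y) (s n)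
    rw [← this]
    have hpre : (fun y : Fin m → ℝ => y + fun α => (n α : ℝ)) ⁻¹' (s n) = s 0 := by
      ext y
      simp [s, funext_iff]
    rw [hpre, setIntegral_congr_set hs0]
    simp_rw [thAmp_shift, hper]
  simp_rw [hpiece] at hU
  rw [← hU.tsum_eq]
  have hS : ∑' n, ∫ y in cube m, thAmp k j n y ^ 2 * W y =
      ∫ y in cube m, ∑' n, thAmp k j n y ^ 2 * W y := by
    have hcn : ∀ n, Continuous (fun y => thAmp k j n y ^ 2 * W y) := fun n =>
      ((continuous_thAmp k j n).pow 2).mul hW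
    refine integral_tsum_of_summable_integral_norm
      (fun n => (hcn n).continuousOn.integrableOn_compact (isCompact_cube m)) ?_
    have hint' := hint.norm
    have hU' := (hasSum_integral_iUnion (μ := volume) hsm hsd hint'.integrableOn).summable
    refine hU'.congr fun n => ?_
    have hmp := measurePreserving_add_right (volume : Measure (Fin m → ℝ)) (fun α => (n α : ℝ))
    have := hmp.setIntegral_preimage_emb (measurableEmbedding_addRight _)
      (fun y => ‖thAmp k j 0 y ^ 2 * W y‖) (s n)
    rw [← this]
    have hpre : (fun y : Fin m → ℝ => y + fun α => (n α : ℝ)) ⁻¹' (s n) = s 0 := by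
      ext y
      simp [s, funext_iff]
    rw [hpre, setIntegral_congr_set hs0]
    simp_rw [thAmp_shift, hper]
  rw [hS]
  simp_rw [tsum_mul_right]

lemma swap_step {m : ℕ} (k : ℕ) (hk : 0 < k) (j : Fin m → ℤ)
    (hj : ∀ α, 0 ≤ j α ∧ j α < k) (W : (Fin m → ℝ) → ℝ) (hW : Continuous W) :
    ∫ x in cube m, ∫ y in cube m, ‖∑' n, (thAmp k j n y : ℂ) * thPhase k j n x‖ ^ 2 * W y =
    ∫ y in cube m, (∑' n, thAmp k j n y ^ 2) * W y := by
  rw [integral_integral_swap]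
  · refine setIntegral_congr_fun (MeasurableSet.univ_pi fun _ => measurableSet_Icc) fun y hy => ?_
    rw [integral_mul_const, parseval k hk j _ (fun n => (thAmp_pos k j n y).le)
      (thAmp_summable k hk j hj y hy)]
  · rw [Measure.prod_restrict]
    refine ContinuousOn.integrableOn_compact ((isCompact_cube m).prod (isCompact_cube m)) ?_
    have h : ContinuousOn (fun q : (Fin m → ℝ) × (Fin m → ℝ) =>
        ∑' n, (thAmp k j n q.2 : ℂ) * thPhase k j n q.1) (cube m ×ˢ cube m) := by
      refine continuousOn_tsum (u := fun n => thBound k n) (fun n => ?_) (thBound_summable k hk) ?_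
      · have := continuous_thPhase k j n
        have := continuous_thAmp k j n
        fun_prop
      · intro n q hq
        rw [norm_mul, norm_thPhase, mul_one, Complex.norm_real, Real.norm_eq_abs,
          abs_of_pos (thAmp_pos k j n _)]
        exact thAmp_le k hk j hj n _ hq.2
    exact (h.norm.pow 2).mul (hW.comp continuous_snd).continuousOn

lemma continuous_hess {m : ℕ} (ψ : (Fin m → ℝ) → ℝ) (hψ : ContDiff ℝ (⊤ : ℕ∞) ψ) :
    Continuous (hess ψ) := by
  refine continuous_matrix fun a b => ?_
  simp only [hess, Matrix.of_apply]
  have h1 : ContDiff ℝ 1 (fun v => fderiv ℝ ψ v (Pi.single b 1)) :=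
    (hψ.fderiv_right (m := 1) (by
      rw [one_add_one_eq_two]; exact WithTop.coe_le_coe.2 (le_top : (2 : ℕ∞) ≤ ⊤))).clm_apply contDiff_const
  exact (h1.continuous_fderiv one_ne_zero).clm_apply continuous_const

lemma hess_periodic {m : ℕ} (ψ : (Fin m → ℝ) → ℝ) (c : Fin m → ℝ)
    (hper : ∀ y, ψ (y + c) = ψ y) (y : Fin m → ℝ) : hess ψ (y + c) = hess ψ y := by
  have h1 : ∀ v, fderiv ℝ ψ (v + c) = fderiv ℝ ψ v := by
    intro v
    rw [← fderiv_comp_add_right]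
    simp_rw [hper]
  ext a b
  simp only [hess, Matrix.of_apply]
  rw [← fderiv_comp_add_right]
  simp_rw [h1]

/-- The squared norm of `θ_j` with respect to the metric `e^{-2πy²-4πψ}` unfolds
to a Gaussian-type integral over the universal cover `ℝ^m`. -/
theorem theta_norm_formula {m : ℕ} (k : ℕ) (hk : 0 < k)
    (ψ : (Fin m → ℝ) → ℝ) (hψ : ContDiff ℝ (⊤ : ℕ∞) ψ)
    (hper : ∀ (y : Fin m → ℝ) (n : Fin m → ℤ), ψ (y + fun α => (n α : ℝ)) = ψ y)
    (j : Fin m → ℤ) (hj : ∀ α, 0 ≤ j α ∧ j α < k) :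
    (4 * π) ^ m *
      (∫ x in Set.pi Set.univ fun _ : Fin m => Set.Icc (0:ℝ) 1,
        ∫ y in Set.pi Set.univ fun _ : Fin m => Set.Icc (0:ℝ) 1,
          ‖theta k j (fun α => (x α : ℂ) + Complex.I * (y α : ℂ))‖ ^ 2
            * Real.exp (-2 * k * π * (∑ α, (y α) ^ 2) - 4 * k * π * ψ y)
            * (1 + hess ψ y).det)
    = (4 * π) ^ m *
      ∫ y : Fin m → ℝ,
        Real.exp (-2 * k * π * (∑ α, (y α + (j α : ℝ) / k) ^ 2))
          * Real.exp (-4 * k * π * ψ y) * (1 + hess ψ y).det := by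
  have hk' : (k : ℝ) ≠ 0 := by exact_mod_cast hk.ne'
  let W : (Fin m → ℝ) → ℝ := fun y => Real.exp (-4 * k * π * ψ y) * (1 + hess ψ y).det
  have hWc : Continuous W := by
    have h1 := continuous_hess ψ hψ
    have h2 := hψ.continuous
    have h3 : Continuous (fun y => (1 + hess ψ y).det) :=
      Continuous.matrix_det (continuous_const.add h1)
    simp only [W]
    fun_prop
  have hWp : ∀ (y : Fin m → ℝ) (n : Fin m → ℤ), W (y + fun α => (n α : ℝ)) = W y := by
    intro y n
    simp only [W]
    rw [hper, hess_periodic ψ _ (fun y => hper y n)]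
  congr 1
  have hL : ∀ x y : Fin m → ℝ,
      ‖theta k j (fun α => (x α : ℂ) + Complex.I * (y α : ℂ))‖ ^ 2
            * Real.exp (-2 * k * π * (∑ α, (y α) ^ 2) - 4 * k * π * ψ y)
            * (1 + hess ψ y).det =
      ‖∑' n, (thAmp k j n y : ℂ) * thPhase k j n x‖ ^ 2 * W y := by
    intro x y
    rw [← norm_theta_sq k hk, sub_eq_add_neg, Real.exp_add]
    simp only [W]
    rw [show -(4 * (k:ℝ) * π * ψ y) = -4 * k * π * ψ y by ring]
    ring
  have hR : ∀ y : Fin m → ℝ,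
      Real.exp (-2 * k * π * (∑ α, (y α + (j α : ℝ) / k) ^ 2))
          * Real.exp (-4 * k * π * ψ y) * (1 + hess ψ y).det = thAmp k j 0 y ^ 2 * W y := by
    intro y
    simp only [W, thAmp]
    rw [← Real.exp_nat_mul, mul_assoc]
    congr 2
    simp
    ring
  simp_rw [hL, hR]
  rw [← unfold_integral k hk j hj W hWc hWp]
  exact swap_step k hk j hj W hWc
end
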